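/- (Kirchhoff–Sobolev representation formula on the Minkowski backward null cone, scalar wave equation with a first-order term.) Let φ, ψ ∈ C^∞(ℝ × ℝ³) and let P = (P₀, P⃗) be a smooth 1-form on ℝ × ℝ³ such that −∂_t²φ + Δφ − P₀ ∂_tφ + ⟨P⃗, ∇_xφ⟩ = ψ on ℝ × ℝ³. Fix p = (t₀,x₀) and v₀ > 0. Define B(v,ω) = exp( (1/2) ∫₀^v P(L)(γ(u,ω)) du ) for (v,ω) ∈ [0,v₀] × S², and A(v,ω) = B(v,ω)/v. Define ν(v,ω) = −div̸P + (1/2) ∂_v[ P(L̄)(γ(v,ω)) ] + (1/(2v)) P(L̄) − (1/(2v)) P(L) + (1/4) P(L)·P(L̄), all evaluated at γ(v,ω). Then: 4π φ(t₀,x₀) = − ∫_N A ψ − ∫_N ⟨∇̸A, ∇̸φ⟩ − ∫_N ⟨P_tan, ∇̸A⟩ φ + ∫_N ν A φ + v₀ ∫_{S²} B(v₀,ω) [ (1/v₀) φ − L̄φ − (1/2) P(L̄) φ ](γ(v₀,ω)) dσ(ω). -/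

import Mathlib

open MeasureTheory Metric Real
open scoped RealInnerProductSpace

noncomputable section

abbrev E3 := EuclideanSpace ℝ (Fin 3)

/-- The surface measure on the unit sphere `S² ⊆ ℝ³` (total mass `4π`). -/
def sphMeasure : Measure (sphere (0 : E3) 1) := (volume : Measure E3).toSphere

/-- Laplacian of `f : ℝ³ → ℝ`. -/
def lap (f : E3 → ℝ) (x : E3) : ℝ :=
  ∑ i : Fin 3,
    fderiv ℝ (fun y => fderiv ℝ f y (EuclideanSpace.single i (1:ℝ))) x
      (EuclideanSpace.single i (1:ℝ))

/-- Time derivative `∂_t φ`. -/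
def dt (φ : ℝ × E3 → ℝ) (q : ℝ × E3) : ℝ := deriv (fun s => φ (s, q.2)) q.1

/-- Spatial gradient `∇_x φ`. -/
def gradx (φ : ℝ × E3 → ℝ) (q : ℝ × E3) : E3 := gradient (fun y => φ (q.1, y)) q.2

/-- The parametrization `γ(v,ω) = (t₀ − v, x₀ + vω)` of the past null cone of `p = (t₀,x₀)`. -/
def nullGen (p : ℝ × E3) (v : ℝ) (ω : E3) : ℝ × E3 := (p.1 - v, p.2 + v • ω)

/-- `P(L) = −P₀ + ⟨ω, P⃗⟩` at the spacetime point `q`, in the null direction attached to `ω`. -/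
def PL (P : ℝ × E3 → ℝ × E3) (q : ℝ × E3) (ω : E3) : ℝ := -(P q).1 + ⟪ω, (P q).2⟫

/-- `P(L̄) = −P₀ − ⟨ω, P⃗⟩`. -/
def PLbar (P : ℝ × E3 → ℝ × E3) (q : ℝ × E3) (ω : E3) : ℝ := -(P q).1 - ⟪ω, (P q).2⟫

/-- The sphere-tangential part `P_tan = P⃗ − ⟨ω,P⃗⟩ω`. -/
def Ptan (P : ℝ × E3 → ℝ × E3) (q : ℝ × E3) (ω : E3) : E3 :=
  (P q).2 - ⟪ω, (P q).2⟫ • ω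

/-- Tangential divergence of `P` on the sphere of radius `v`:
`div̸P = Σ_{i,j} (δ_{ij} − ω_iω_j) ∂_j P⃗_i − (2/v)⟨ω, P⃗⟩` (spatial partials at `q`). -/
def slashDivP (P : ℝ × E3 → ℝ × E3) (q : ℝ × E3) (ω : E3) (v : ℝ) : ℝ :=
  (∑ i : Fin 3, ∑ j : Fin 3,
      ((if i = j then (1:ℝ) else 0) - ω i * ω j) *
        fderiv ℝ (fun y => (P (q.1, y)).2 i) q.2 (EuclideanSpace.single j (1:ℝ)))
    - (2 / v) * ⟪ω, (P q).2⟫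

/-- `B(v,ω) = exp( (1/2) ∫₀^v P(L)(γ(u,ω)) du )`. -/
def coneB (P : ℝ × E3 → ℝ × E3) (p : ℝ × E3) (v : ℝ) (ω : E3) : ℝ :=
  Real.exp ((1/2) * ∫ u in (0:ℝ)..v, PL P (nullGen p u ω) ω)

/-- `A(v,ω) = B(v,ω)/v`. -/
def coneA (P : ℝ × E3 → ℝ × E3) (p : ℝ × E3) (v : ℝ) (ω : E3) : ℝ := coneB P p v ω / v

/-- The error coefficient
`ν = −div̸P + (1/2) ∂_v[P(L̄)∘γ] + (1/(2v)) P(L̄) − (1/(2v)) P(L) + (1/4) P(L)·P(L̄)`,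
evaluated at `γ(v,ω)`. -/
def nuP (P : ℝ × E3 → ℝ × E3) (p : ℝ × E3) (v : ℝ) (ω : E3) : ℝ :=
  -slashDivP P (nullGen p v ω) ω v
    + (1/2) * deriv (fun w => PLbar P (nullGen p w ω) ω) v
    + (1/(2*v)) * PLbar P (nullGen p v ω) ω
    - (1/(2*v)) * PL P (nullGen p v ω) ω
    + (1/4) * PL P (nullGen p v ω) ω * PLbar P (nullGen p v ω) ω

/-- Tangential gradient of a function `h(v,ω)` on the cone: `(1/v)` times the Euclidean
gradient at `ω` of the `0`-homogeneous extension `x ↦ h(v, x/|x|)`. -/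
def slashGradCone (h : ℝ → E3 → ℝ) (v : ℝ) (ω : E3) : E3 :=
  (1/v) • gradient (fun x => h v (‖x‖⁻¹ • x)) ω

/-- Tangential gradient `∇̸u = ∇_xu − (ω·∇_xu)ω` of a spacetime function at a cone point. -/
def slashGradSpace (u : ℝ × E3 → ℝ) (q : ℝ × E3) (ω : E3) : E3 :=
  gradx u q - ⟪ω, gradx u q⟫ • ω

/-- The conjugate null derivative `L̄u = −∂_tu − ω·∇_xu`. -/
def Lbar (u : ℝ × E3 → ℝ) (q : ℝ × E3) (ω : E3) : ℝ := -dt u q - ⟪ω, gradx u q⟫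

/-- Null cone integral `∫_N f = ∫₀^{v₀} ∫_{S²} v² f(v,ω) dσ(ω) dv`. -/
def coneInt (v₀ : ℝ) (f : ℝ → E3 → ℝ) : ℝ :=
  ∫ v in (0:ℝ)..v₀, ∫ ω : sphere (0 : E3) 1, v ^ 2 * f v (ω : E3) ∂sphMeasure



lemma sph_finite : IsFiniteMeasure sphMeasure := by unfold sphMeasure; infer_instance

lemma sph_mass : sphMeasure.real Set.univ = 4 * π := by
  unfold sphMeasure
  rw [Measure.toSphere_real_apply_univ]
  simp only [Measure.real, EuclideanSpace.volume_ball_fin_three]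
  simp
  rw [ENNReal.toReal_ofReal (by positivity)]
  ring

/-- the polar decomposition for products -/
lemma polar_mul (g : ℝ → ℝ) (h : E3 → ℝ) :
    ∫ x : E3, g ‖x‖ * h (‖x‖⁻¹ • x) =
      (∫ ω : sphere (0 : E3) 1, h ω ∂sphMeasure) *
        ∫ r : Set.Ioi (0:ℝ), g r ∂(Measure.volumeIoiPow 2) := by
  calc ∫ x : E3, g ‖x‖ * h (‖x‖⁻¹ • x)
      = ∫ x : ({(0)}ᶜ : Set E3), g ‖x.1‖ * h (‖x.1‖⁻¹ • x.1) ∂((volume : Measure E3).comap (↑)) := by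
        rw [integral_subtype_comap (measurableSet_singleton _).compl
          fun x : E3 ↦ g ‖x‖ * h (‖x‖⁻¹ • x), restrict_compl_singleton]
    _ = ∫ z, h z.1 * g z.2 ∂((volume : Measure E3).toSphere.prod
          (Measure.volumeIoiPow (Module.finrank ℝ E3 - 1))) := by
        have := (volume : Measure E3).measurePreserving_homeomorphUnitSphereProd.integral_comp
          (Homeomorph.measurableEmbedding _)
          (fun z : sphere (0:E3) 1 × Set.Ioi (0:ℝ) => h z.1 * g z.2)
        rw [← this]
        refine integral_congr_ae (Filter.Eventually.of_forall fun x => ?_)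
        simp [mul_comm]
    _ = _ := by
        have : Module.finrank ℝ E3 - 1 = 2 := by simp
        rw [this]
        exact integral_prod_mul (fun ω : sphere (0:E3) 1 => h ω) (fun r : Set.Ioi (0:ℝ) => g r)

/-- tangential projection -/
def tp (ω e : E3) : E3 := e - ⟪ω, e⟫ • ω

lemma hasFDerivAt_nrm {x : E3} (hx : x ≠ 0) :
    HasFDerivAt (fun y : E3 => ‖y‖) (innerSL ℝ (‖x‖⁻¹ • x)) x := by
  have h := (hasStrictFDerivAt_norm_sq x).hasFDerivAt.sqrt
    (by simpa using hx)
  have e : (fun y : E3 => √(‖y‖ ^ 2)) = fun y => ‖y‖ := by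
    ext y; exact Real.sqrt_sq (norm_nonneg y)
  rw [e] at h
  have h0 : ‖x‖ ≠ 0 := norm_ne_zero_iff.2 hx
  have e2 : innerSL ℝ (‖x‖⁻¹ • x) = (1 / (2 * √(‖x‖ ^ 2))) • 2 • (innerSL ℝ) x := by
    rw [Real.sqrt_sq (norm_nonneg x)]
    ext1 y
    simp
    field_simp
  rw [e2]
  exact h

lemma hasFDerivAt_unit {x : E3} (hx : x ≠ 0) :
    ∃ N : E3 →L[ℝ] E3, HasFDerivAt (fun y : E3 => ‖y‖⁻¹ • y) N x ∧
      ∀ e, N e = ‖x‖⁻¹ • tp (‖x‖⁻¹ • x) e := by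
  have h0 : ‖x‖ ≠ 0 := norm_ne_zero_iff.2 hx
  have h1 := (hasDerivAt_inv h0).comp_hasFDerivAt x (hasFDerivAt_nrm hx)
  have h2 := h1.smul (hasFDerivAt_id x)
  refine ⟨_, h2, fun e => ?_⟩
  simp [tp, inner_smul_left, smul_sub, smul_smul]
  rw [sub_eq_add_neg, ← neg_smul]
  congr 1
  rw [← neg_smul]
  congr 1
  field_simp

lemma contDiffAt_unit {x : E3} (hx : x ≠ 0) :
    ContDiffAt ℝ 1 (fun y : E3 => ‖y‖⁻¹ • y) x :=
  ((contDiffAt_norm ℝ hx).inv (norm_ne_zero_iff.2 hx)).smul contDiffAt_id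

lemma radial_integrable (g : ℝ → ℝ) (hg : ∀ r ≠ 0, ContinuousAt g r) (h1 : ∀ r < 1, g r = 0)
    (h3 : ∀ r > 3, g r = 0) (H : E3 → ℝ) (hH : Continuous H) :
    Integrable (fun x : E3 => g ‖x‖ * H (‖x‖⁻¹ • x)) := by
  apply Continuous.integrable_of_hasCompactSupport
  · rw [continuous_iff_continuousAt]
    intro x
    by_cases hx : x = 0
    · have : (fun x : E3 => g ‖x‖ * H (‖x‖⁻¹ • x)) =ᶠ[nhds x] fun _ => 0 := by
        filter_upwards [(continuous_norm.isOpen_preimage _ isOpen_Iio).mem_nhds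
          (show x ∈ (fun y : E3 => ‖y‖) ⁻¹' Set.Iio 1 by simp [hx])] with y hy
        rw [h1 _ hy, zero_mul]
      exact continuousAt_const.congr this.symm
    · refine ContinuousAt.mul ?_ ?_
      · exact ContinuousAt.comp (g := g) (f := fun y : E3 => ‖y‖)
          (hg _ (norm_ne_zero_iff.2 hx)) continuous_norm.continuousAt
      · exact ContinuousAt.comp (g := H) (f := fun y : E3 => ‖y‖⁻¹ • y)
          hH.continuousAt (contDiffAt_unit hx).continuousAt
  · refine HasCompactSupport.intro (isCompact_closedBall (0:E3) 3) fun x hx => ?_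
    have : ‖x‖ > 3 := by simpa using hx
    simp [h3 _ this]

/-- key relation -/
lemma sphere_div_aux (χ : ℝ → ℝ) (hχ : ContDiff ℝ 1 χ) (h1 : ∀ r < 1, χ r = 0)
    (h3 : ∀ r > 3, χ r = 0) (H : E3 → ℝ) (hH : ContDiff ℝ 1 H) (e : E3) :
    (∫ ω : sphere (0 : E3) 1, ⟪(ω:E3), e⟫ * H ω ∂sphMeasure) *
        (∫ r : Set.Ioi (0:ℝ), deriv χ r ∂(Measure.volumeIoiPow 2)) +
    (∫ ω : sphere (0 : E3) 1, fderiv ℝ H ω (tp ω e) ∂sphMeasure) *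
        (∫ r : Set.Ioi (0:ℝ), χ r * (r:ℝ)⁻¹ ∂(Measure.volumeIoiPow 2)) = 0 := by
  set F : E3 → ℝ := fun x => χ ‖x‖ * H (‖x‖⁻¹ • x) with hF
  have hF0 : ∀ x : E3, ‖x‖ < 1 → F x = 0 := fun x hx => by simp [hF, h1 _ hx]
  have hFs : HasCompactSupport F := by
    refine HasCompactSupport.intro (isCompact_closedBall (0:E3) 3) fun x hx => ?_
    have : ‖x‖ > 3 := by simpa using hx
    simp [hF, h3 _ this]
  have hFC : ContDiff ℝ 1 F := by
    rw [contDiff_iff_contDiffAt]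
    intro x
    by_cases hx : x = 0
    · have : F =ᶠ[nhds x] fun _ => 0 := by
        filter_upwards [(continuous_norm.isOpen_preimage _ isOpen_Iio).mem_nhds
          (show x ∈ (fun y : E3 => ‖y‖) ⁻¹' Set.Iio 1 by simp [hx])] with y hy
        exact hF0 y hy
      exact contDiffAt_const.congr_of_eventuallyEq this
    · exact (hχ.contDiffAt.comp x (contDiffAt_norm ℝ hx)).mul
        (hH.contDiffAt.comp x (contDiffAt_unit hx))
  have hd : ∀ x : E3, x ≠ 0 → fderiv ℝ F x e =
      deriv χ ‖x‖ * (⟪‖x‖⁻¹ • x, e⟫ * H (‖x‖⁻¹ • x)) +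
      (χ ‖x‖ * ‖x‖⁻¹) * (fderiv ℝ H (‖x‖⁻¹ • x) (tp (‖x‖⁻¹ • x) e)) := by
    intro x hx
    obtain ⟨N, hN, hN'⟩ := hasFDerivAt_unit hx
    have a := ((hχ.differentiable one_ne_zero).differentiableAt (x := ‖x‖)).hasDerivAt.comp_hasFDerivAt x
      (hasFDerivAt_nrm hx)
    have b := ((hH.differentiable one_ne_zero).differentiableAt (x := ‖x‖⁻¹ • x)).hasFDerivAt.comp (f := fun y : E3 => ‖y‖⁻¹ • y) x hN
    have c := a.mul b
    have : fderiv ℝ F x = _ := c.fderiv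
    rw [this]
    simp only [real_inner_smul_left]
    simp [hN']
    ring
  have hdc : Continuous fun x => fderiv ℝ F x e :=
    (hFC.continuous_fderiv one_ne_zero).clm_apply continuous_const
  have hds : HasCompactSupport fun x => fderiv ℝ F x e := hFs.fderiv_apply (𝕜 := ℝ) e
  have hz : ∫ x, fderiv ℝ F x e = 0 := by
    have := integral_mul_fderiv_eq_neg_fderiv_mul_of_integrable (μ := (volume : Measure E3))
      (f := fun _ => (1:ℝ)) (g := F) (v := e) (by simp)
      (by simpa using hdc.integrable_of_hasCompactSupport hds)
      (by simpa using hFC.continuous.integrable_of_hasCompactSupport hFs)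
      (by intros; fun_prop) (fun x _ => hFC.differentiable one_ne_zero x)
    simpa using this
  have hcd : Continuous (deriv χ) := hχ.continuous_deriv le_rfl
  have hd1 : ∀ r < 1, deriv χ r = 0 := fun r hr => by
    have : χ =ᶠ[nhds r] fun _ => 0 := by
      filter_upwards [isOpen_Iio.mem_nhds (show r ∈ Set.Iio 1 from hr)] with y hy using h1 y hy
    rw [this.deriv_eq]; simp
  have hd3 : ∀ r > 3, deriv χ r = 0 := fun r hr => by
    have : χ =ᶠ[nhds r] fun _ => 0 := by
      filter_upwards [isOpen_Ioi.mem_nhds (show r ∈ Set.Ioi 3 from hr)] with y hy using h3 y hy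
    rw [this.deriv_eq]; simp
  have hDH : Continuous fun ω : E3 => fderiv ℝ H ω (tp ω e) := by
    refine (hH.continuous_fderiv one_ne_zero).clm_apply ?_
    unfold tp; fun_prop
  have i1 := radial_integrable (deriv χ) (fun r _ => hcd.continuousAt) hd1 hd3
    (fun ω => ⟪ω, e⟫ * H ω) (by have := hH.continuous; fun_prop)
  have i2 := radial_integrable (fun r => χ r * r⁻¹)
    (fun r hr => hχ.continuous.continuousAt.mul (continuousAt_inv₀ hr))
    (fun r hr => by simp [h1 r hr]) (fun r hr => by simp [h3 r hr])
    (fun ω => fderiv ℝ H ω (tp ω e)) hDH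
  rw [← polar_mul (deriv χ) (fun ω => ⟪ω, e⟫ * H ω),
    ← polar_mul (fun r => χ r * r⁻¹) (fun ω => fderiv ℝ H ω (tp ω e)), ← integral_add i1 i2, ← hz]
  refine integral_congr_ae ?_
  have : ∀ᵐ x : E3, x ≠ 0 := by simp [ae_iff]
  filter_upwards [this] with x hx
  exact (hd x hx).symm

lemma sph_cont_integrable {f : E3 → ℝ} (hf : Continuous f) :
    Integrable (fun ω : sphere (0 : E3) 1 => f ω) sphMeasure := by
  have := sph_finite
  exact (hf.comp continuous_subtype_val).integrable_of_hasCompactSupport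
    (HasCompactSupport.of_compactSpace _)

/-- divergence theorem on the sphere -/
lemma sphere_div (H : E3 → ℝ) (hH : ContDiff ℝ 1 H) (e : E3) :
    (∫ ω : sphere (0 : E3) 1, fderiv ℝ H ω (tp ω e) ∂sphMeasure) =
      2 * ∫ ω : sphere (0 : E3) 1, ⟪(ω:E3), e⟫ * H ω ∂sphMeasure := by
  let χ : ContDiffBump (2:ℝ) := ⟨1/2, 1, by norm_num, by norm_num⟩
  have hχ : ContDiff ℝ 1 χ := χ.contDiff
  have h1 : ∀ r < 1, χ r = 0 := fun r hr => χ.zero_of_le_dist (by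
    show (1:ℝ) ≤ _
    rw [Real.dist_eq, abs_sub_comm, le_abs]; left; linarith)
  have h3 : ∀ r > 3, χ r = 0 := fun r hr => χ.zero_of_le_dist (by
    show (1:ℝ) ≤ _
    rw [Real.dist_eq, le_abs]; left; linarith)
  set a := ∫ r : Set.Ioi (0:ℝ), deriv χ r ∂(Measure.volumeIoiPow 2) with ha
  set b := ∫ r : Set.Ioi (0:ℝ), χ r * (r:ℝ)⁻¹ ∂(Measure.volumeIoiPow 2) with hb
  have key := fun H hH e => sphere_div_aux χ hχ h1 h3 H hH e
  have hπ : (0:ℝ) < 4 * π := by positivity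
  have hb0 : b ≠ 0 := by
    have p := polar_mul (fun r => χ r * r⁻¹) (fun _ => 1)
    simp only [mul_one, integral_const, smul_eq_mul, sph_mass] at p
    have i := radial_integrable (fun r => χ r * r⁻¹)
      (fun r hr => hχ.continuous.continuousAt.mul (continuousAt_inv₀ hr))
      (fun r hr => by simp [h1 r hr]) (fun r hr => by simp [h3 r hr])
      (fun ω => 1) continuous_const
    simp only [mul_one] at i
    intro h0
    rw [← hb, h0, mul_zero] at p
    rw [integral_eq_zero_iff_of_nonneg (fun x => mul_nonneg χ.nonneg (by positivity)) i] at p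
    have hU : IsOpen {x : E3 | 3/2 < ‖x‖ ∧ ‖x‖ < 5/2} :=
      (isOpen_lt continuous_const continuous_norm).inter
        (isOpen_lt continuous_norm continuous_const)
    have hpos : 0 < volume {x : E3 | 3/2 < ‖x‖ ∧ ‖x‖ < 5/2} :=
      hU.measure_pos _ ⟨EuclideanSpace.single 0 2, by simp; norm_num⟩
    have : volume {x : E3 | 3/2 < ‖x‖ ∧ ‖x‖ < 5/2} = 0 := by
      refine measure_mono_null ?_ (ae_iff.1 p)
      rintro x ⟨hx1, hx2⟩
      have : χ ‖x‖ = 1 := χ.one_of_mem_closedBall (by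
        show dist _ _ ≤ (1/2:ℝ)
        rw [Real.dist_eq, abs_le]; constructor <;> linarith)
      simp [this]
      rintro rfl
      simp at hx1; linarith
    exact hpos.ne' this
  have hab : a = -2 * b := by
    have k : ∀ i : Fin 3, (∫ ω : sphere (0 : E3) 1, ((ω:E3) i) ^ 2 ∂sphMeasure) * a +
        (∫ ω : sphere (0 : E3) 1, (1 - ((ω:E3) i) ^ 2) ∂sphMeasure) * b = 0 := by
      intro i
      have := key (fun x => x i) (by fun_prop) (EuclideanSpace.single i 1)
      rw [← ha, ← hb] at this
      rw [← this]
      congr 3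
      · ext ω; simp [EuclideanSpace.inner_single_right]; ring
      · ext ω
        have : fderiv ℝ (fun x : E3 => x i) ω = EuclideanSpace.proj i :=
          (EuclideanSpace.proj (𝕜 := ℝ) i).fderiv
        rw [this]
        simp [tp, EuclideanSpace.inner_single_right]; ring
    have ii : ∀ i : Fin 3, Integrable (fun ω : sphere (0 : E3) 1 => ((ω:E3) i) ^ 2) sphMeasure :=
      fun i => sph_cont_integrable (f := fun x => (x i)^2) (by fun_prop)
    have := sph_finite
    have s : ∑ i : Fin 3, ∫ ω : sphere (0 : E3) 1, ((ω:E3) i) ^ 2 ∂sphMeasure = 4 * π := by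
      rw [← integral_finsetSum _ (fun i _ => ii i)]
      have : ∀ ω : sphere (0 : E3) 1, ∑ i : Fin 3, ((ω:E3) i) ^ 2 = 1 := by
        intro ω
        rw [← EuclideanSpace.real_norm_sq_eq]; simp
      simp [this, sph_mass]
    simp_rw [integral_sub (integrable_const (1:ℝ)) (ii _)] at k
    simp only [integral_const, sph_mass, smul_eq_mul, mul_one] at k
    have k0 := k 0
    have k1 := k 1
    have k2 := k 2
    rw [Fin.sum_univ_three] at s
    have : (4 * π) * (a + 2 * b) = 0 := by
      linear_combination k0 + k1 + k2 + (b - a) * s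
    rcases mul_eq_zero.1 this with h | h
    · exact absurd h hπ.ne'
    · linarith
  have := key H hH e
  rw [← ha, ← hb, hab] at this
  have h2 : b * ((∫ ω : sphere (0 : E3) 1, fderiv ℝ H ω (tp ω e) ∂sphMeasure) -
      2 * ∫ ω : sphere (0 : E3) 1, ⟪(ω:E3), e⟫ * H ω ∂sphMeasure) = 0 := by
    linear_combination this
  rcases mul_eq_zero.1 h2 with h | h
  · exact absurd h hb0
  · linarith


lemma param_contDiff (F : (ℝ × E3) × ℝ → ℝ) (hF : ContDiff ℝ 1 F) :
    ContDiff ℝ 1 (fun z : ℝ × E3 => ∫ s in (0:ℝ)..1, F (z, s)) := by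
  let F' : ℝ × E3 → ℝ → (ℝ × E3 →L[ℝ] ℝ) := fun z s =>
    (fderiv ℝ F (z, s)).comp (ContinuousLinearMap.inl ℝ (ℝ × E3) ℝ)
  have hF'c : Continuous (Function.uncurry F') := by
    have := hF.continuous_fderiv one_ne_zero
    exact (this.comp (by fun_prop : Continuous fun z : (ℝ × E3) × ℝ => (z.1, z.2))).clm_comp
      continuous_const
  have hd : ∀ z, HasFDerivAt (fun z : ℝ × E3 => ∫ s in (0:ℝ)..1, F (z, s))
      (∫ s in (0:ℝ)..1, F' z s) z := by
    intro z
    obtain ⟨C, hC⟩ := ((isCompact_closedBall z 1).prod (isCompact_Icc (a := (0:ℝ)) (b := 1))).exists_bound_of_continuousOn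
      hF'c.continuousOn
    have hs : ∀ z, Continuous fun s => F (z, s) := fun z => hF.continuous.comp (by fun_prop)
    refine intervalIntegral.hasFDerivAt_integral_of_dominated_of_fderiv_le (bound := fun _ => C)
      (F := fun z s => F (z, s)) (F' := F')
      (closedBall_mem_nhds z one_pos) ?_ ?_ ?_ ?_ ?_ ?_
    · exact Filter.Eventually.of_forall fun y => (hs y).aestronglyMeasurable
    · exact (hs z).intervalIntegrable _ _
    · exact (hF'c.comp (by fun_prop : Continuous fun s : ℝ => (z, s))).aestronglyMeasurable
    · refine Filter.Eventually.of_forall fun t ht x hx => hC (x, t) ⟨hx, ?_⟩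
      rw [Set.uIoc_of_le zero_le_one] at ht
      exact ⟨ht.1.le, ht.2⟩
    · exact intervalIntegrable_const
    · refine Filter.Eventually.of_forall fun t ht x hx => ?_
      have a := (hF.differentiable one_ne_zero (x, t)).hasFDerivAt
      exact a.comp x (f := fun x => (x, t)) (hasFDerivAt_prodMk_left x t)
  rw [contDiff_one_iff_fderiv]
  refine ⟨fun z => (hd z).differentiableAt, ?_⟩
  have : fderiv ℝ (fun z : ℝ × E3 => ∫ s in (0:ℝ)..1, F (z, s)) = fun z => ∫ s in (0:ℝ)..1, F' z s :=
    funext fun z => (hd z).fderiv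
  rw [this]
  exact intervalIntegral.continuous_parametric_intervalIntegral_of_continuous' hF'c 0 1

lemma primitive_contDiff (k : ℝ × E3 → ℝ) (hk : ContDiff ℝ 1 k) :
    ContDiff ℝ 1 (fun z : ℝ × E3 => ∫ u in (0:ℝ)..z.1, k (u, z.2)) := by
  have := param_contDiff (fun y => y.1.1 * k (y.2 * y.1.1, y.1.2))
    (contDiff_fst.fst.mul (hk.comp (by fun_prop)))
  convert this using 1
  ext z
  simp only
  rw [intervalIntegral.integral_const_mul]
  have := intervalIntegral.smul_integral_comp_mul_right (a := 0) (b := 1) (fun u => k (u, z.2)) z.1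
  simpa using this.symm

lemma sph_param_cont {g : ℝ × E3 → ℝ} (hg : Continuous g) :
    Continuous fun v : ℝ => ∫ ω : sphere (0 : E3) 1, g (v, ω) ∂sphMeasure := by
  have := sph_finite
  have h := continuous_parametric_integral_of_continuous (μ := sphMeasure)
    (f := fun (v : ℝ) (ω : sphere (0 : E3) 1) => g (v, ω))
    (hg.comp (by fun_prop : Continuous fun z : ℝ × sphere (0 : E3) 1 => (z.1, (z.2 : E3))))
    (s := Set.univ) isCompact_univ
  simpa using h

lemma sph_ftc (J J' : ℝ × E3 → ℝ) (hJ : Continuous J) (hJ' : Continuous J')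
    (hd : ∀ v ω, HasDerivAt (fun v => J (v, ω)) (J' (v, ω)) v) (v₀ : ℝ) (hv₀ : 0 < v₀) :
    ∫ v in (0:ℝ)..v₀, ∫ ω : sphere (0 : E3) 1, J' (v, ω) ∂sphMeasure =
      (∫ ω : sphere (0 : E3) 1, J (v₀, ω) ∂sphMeasure) -
        ∫ ω : sphere (0 : E3) 1, J (0, ω) ∂sphMeasure := by
  have := sph_finite
  rw [intervalIntegral.integral_of_le hv₀.le, integral_integral_swap]
  · rw [← integral_sub]
    · refine integral_congr_ae (Filter.Eventually.of_forall fun ω => ?_)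
      simp only
      rw [← intervalIntegral.integral_of_le hv₀.le]
      exact intervalIntegral.integral_eq_sub_of_hasDerivAt (fun v _ => hd v ω)
        ((hJ'.comp (by fun_prop : Continuous fun v : ℝ => (v, (ω:E3)))).intervalIntegrable _ _)
    · exact sph_cont_integrable (f := fun x => J (v₀, x)) (by fun_prop)
    · exact sph_cont_integrable (f := fun x => J (0, x)) (by fun_prop)
  · have hc : Continuous (fun z : ℝ × sphere (0 : E3) 1 => J' (z.1, (z.2:E3))) := by fun_prop
    obtain ⟨C, hC⟩ := ((isCompact_Icc (a := (0:ℝ)) (b := v₀)).prod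
      (isCompact_univ (X := sphere (0 : E3) 1))).exists_bound_of_continuousOn hc.continuousOn
    refine Integrable.of_bound (C := C) hc.aestronglyMeasurable ?_
    have h1 : ∀ᵐ z ∂((volume.restrict (Set.Ioc 0 v₀)).prod sphMeasure), z.1 ∈ Set.Ioc 0 v₀ :=
      Measure.quasiMeasurePreserving_fst.ae (ae_restrict_mem measurableSet_Ioc)
    filter_upwards [h1] with z hz
    exact hC z ⟨⟨hz.1.le, hz.2⟩, trivial⟩

lemma coneInt_eq {v₀ : ℝ} (hv₀ : 0 < v₀) (f : ℝ → E3 → ℝ) (g : ℝ × E3 → ℝ)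
    (h : ∀ v > 0, ∀ ω : E3, ‖ω‖ = 1 → v ^ 2 * f v ω = g (v, ω)) :
    coneInt v₀ f = ∫ v in (0:ℝ)..v₀, ∫ ω : sphere (0 : E3) 1, g (v, ω) ∂sphMeasure := by
  unfold coneInt
  refine intervalIntegral.integral_congr_ae (Filter.Eventually.of_forall fun v hv => ?_)
  rw [Set.uIoc_of_le hv₀.le] at hv
  refine integral_congr_ae (Filter.Eventually.of_forall fun ω => ?_)
  exact h v hv.1 ω (by simp)

/-- coordinate directions -/
def td : ℝ × E3 := (1, 0)
def sd (i : Fin 3) : ℝ × E3 := (0, EuclideanSpace.single i 1)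

lemma dir_decomp (ℓ : ℝ × E3 →L[ℝ] ℝ) (a : ℝ) (y : E3) :
    ℓ (a, y) = a * ℓ td + ∑ i, y i * ℓ (sd i) := by
  have : (a, y) = a • td + ∑ i, y i • sd i := by
    ext j
    · simp [td, sd, Prod.fst_sum]
    · simp [td, sd, Prod.snd_sum, Finset.sum_apply, Pi.single_apply]
  rw [this, map_add, map_sum]
  simp

lemma dt_eq {φ : ℝ × E3 → ℝ} (hφ : Differentiable ℝ φ) (q : ℝ × E3) :
    dt φ q = fderiv ℝ φ q td := by
  unfold dt td
  have h := (hφ q).hasFDerivAt.comp_hasDerivAt q.1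
    ((hasDerivAt_id q.1).prodMk (hasDerivAt_const q.1 q.2))
  exact h.deriv

lemma fderiv_snd_eq {φ : ℝ × E3 → ℝ} (hφ : Differentiable ℝ φ) (t : ℝ) (x : E3) (e : E3) :
    fderiv ℝ (fun y => φ (t, y)) x e = fderiv ℝ φ (t, x) (0, e) := by
  have h := (hφ (t, x)).hasFDerivAt.comp x (f := fun y => (t, y)) (hasFDerivAt_prodMk_right t x)
  have : fderiv ℝ (fun y => φ (t, y)) x = _ := h.fderiv
  rw [this]; simp

lemma gradient_apply' (f : E3 → ℝ) (x : E3) (i : Fin 3) :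
    gradient f x i = fderiv ℝ f x (EuclideanSpace.single i 1) := by
  have : ⟪gradient f x, EuclideanSpace.single i 1⟫ = fderiv ℝ f x (EuclideanSpace.single i 1) := by
    simp [gradient]
  rw [← this, EuclideanSpace.inner_single_right]; simp

lemma gradx_eq {φ : ℝ × E3 → ℝ} (hφ : Differentiable ℝ φ) (q : ℝ × E3) (i : Fin 3) :
    gradx φ q i = fderiv ℝ φ q (sd i) := by
  unfold gradx sd
  rw [gradient_apply', fderiv_snd_eq hφ]

lemma lap_eq {φ : ℝ × E3 → ℝ} (hφ : ContDiff ℝ 2 φ) (q : ℝ × E3) :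
    lap (fun y => φ (q.1, y)) q.2 = ∑ i, fderiv ℝ (fun q => fderiv ℝ φ q (sd i)) q (sd i) := by
  unfold lap
  refine Finset.sum_congr rfl fun i _ => ?_
  have h1 : Differentiable ℝ φ := hφ.differentiable two_ne_zero
  have h2 : Differentiable ℝ (fun q => fderiv ℝ φ q (sd i)) :=
    ((hφ.fderiv_right (m := 1) (by norm_num)).clm_apply contDiff_const).differentiable one_ne_zero
  simp_rw [fderiv_snd_eq h1]
  exact fderiv_snd_eq h2 q.1 q.2 _

lemma snd_symm {φ : ℝ × E3 → ℝ} (hφ : ContDiff ℝ 2 φ) (q a b : ℝ × E3) :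
    fderiv ℝ (fun q => fderiv ℝ φ q a) q b = fderiv ℝ (fun q => fderiv ℝ φ q b) q a := by
  have h : DifferentiableAt ℝ (fderiv ℝ φ) q :=
    (hφ.fderiv_right (m := 1) (by norm_num)).differentiable one_ne_zero q
  rw [fderiv_clm_apply h (differentiableAt_const _), fderiv_clm_apply h (differentiableAt_const _)]
  simp
  exact (hφ.contDiffAt.isSymmSndFDerivAt (by simp)) b a

lemma hasDerivAt_nullGen (p : ℝ × E3) (v : ℝ) (ω : E3) :
    HasDerivAt (fun v => nullGen p v ω) (-1, ω) v := by
  unfold nullGen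
  have a := (hasDerivAt_id v).const_sub p.1
  have b := ((hasDerivAt_id v).smul_const ω).const_add p.2
  simpa using a.prodMk b

lemma hasDerivAt_comp_nullGen {h : ℝ × E3 → ℝ} (hh : Differentiable ℝ h) (p : ℝ × E3) (v : ℝ)
    (ω : E3) : HasDerivAt (fun v => h (nullGen p v ω))
      (-fderiv ℝ h (nullGen p v ω) td + ∑ i, ω i * fderiv ℝ h (nullGen p v ω) (sd i)) v := by
  have := (hh (nullGen p v ω)).hasFDerivAt.comp_hasDerivAt v (hasDerivAt_nullGen p v ω)
  rw [dir_decomp, neg_one_mul] at this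
  exact this

lemma contDiff_nullGen {n : WithTop ℕ∞} (p : ℝ × E3) :
    ContDiff ℝ n (fun z : ℝ × E3 => nullGen p z.1 z.2) := by
  unfold nullGen; fun_prop

lemma fderiv_mul_nullGen {b h : ℝ × E3 → ℝ} (hb : Differentiable ℝ b) (hh : Differentiable ℝ h)
    (p : ℝ × E3) (v : ℝ) (ω e : E3) :
    fderiv ℝ (fun ω => b (v, ω) * h (nullGen p v ω)) ω e =
      fderiv ℝ b (v, ω) (0, e) * h (nullGen p v ω) +
        b (v, ω) * (v * ∑ i, e i * fderiv ℝ h (nullGen p v ω) (sd i)) := by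
  have h1 := (hb (v, ω)).hasFDerivAt.comp ω (f := fun y => (v, y)) (hasFDerivAt_prodMk_right v ω)
  have h2 : HasFDerivAt (fun ω : E3 => nullGen p v ω)
      ((0 : E3 →L[ℝ] ℝ).prod (v • ContinuousLinearMap.id ℝ E3)) ω := by
    unfold nullGen
    exact (hasFDerivAt_const _ _).prodMk (((hasFDerivAt_id ω).const_smul v).const_add p.2)
  have h3 := (hh (nullGen p v ω)).hasFDerivAt.comp ω h2
  have : fderiv ℝ (fun ω => b (v, ω) * h (nullGen p v ω)) ω = _ := (h1.mul h3).fderiv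
  rw [this]
  have d := dir_decomp (fderiv ℝ h (nullGen p v ω)) 0 (v • e)
  simp [d, Finset.mul_sum]
  simp [Fin.sum_univ_three]; ring


lemma inner_eq3 (x y : E3) : ⟪x, y⟫ = ∑ i, x i * y i := by
  rw [PiLp.inner_apply]
  exact Finset.sum_congr rfl fun i _ => by simp [mul_comm]

lemma tp_apply (ω : E3) (i j : Fin 3) :
    tp ω (EuclideanSpace.single i 1) j = (if i = j then 1 else 0) - ω i * ω j := by
  simp [tp, EuclideanSpace.inner_single_right, eq_comm]

lemma PL_contDiff {P : ℝ × E3 → ℝ × E3} (hP : ContDiff ℝ 1 P) (p : ℝ × E3) :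
    ContDiff ℝ 1 (fun z : ℝ × E3 => PL P (nullGen p z.1 z.2) z.2) := by
  unfold PL
  have h : ContDiff ℝ 1 (fun z : ℝ × E3 => P (nullGen p z.1 z.2)) := hP.comp (contDiff_nullGen p)
  exact h.fst.neg.add (contDiff_snd.inner ℝ h.snd)

lemma coneB_contDiff {P : ℝ × E3 → ℝ × E3} (hP : ContDiff ℝ 1 P) (p : ℝ × E3) :
    ContDiff ℝ 1 (fun z : ℝ × E3 => coneB P p z.1 z.2) := by
  unfold coneB
  exact (contDiff_const.mul (primitive_contDiff _ (PL_contDiff hP p))).exp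

lemma coneB_deriv {P : ℝ × E3 → ℝ × E3} (hP : ContDiff ℝ 1 P) (p : ℝ × E3) (v : ℝ) (ω : E3) :
    HasDerivAt (fun v => coneB P p v ω)
      ((1/2) * PL P (nullGen p v ω) ω * coneB P p v ω) v := by
  unfold coneB
  have hc : Continuous (fun u : ℝ => PL P (nullGen p u ω) ω) :=
    (PL_contDiff hP p).continuous.comp (by fun_prop : Continuous fun u : ℝ => (u, ω))
  have h := ((hc.integral_hasStrictDerivAt 0 v).hasDerivAt.const_mul (1/2)).exp
  rw [mul_comm] at h
  exact h

lemma PLbar_deriv {P : ℝ × E3 → ℝ × E3} (hP : ContDiff ℝ 1 P) (p : ℝ × E3) (v : ℝ) (ω : E3) :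
    HasDerivAt (fun v => PLbar P (nullGen p v ω) ω)
      (-(-fderiv ℝ (fun q => (P q).1) (nullGen p v ω) td
          + ∑ i, ω i * fderiv ℝ (fun q => (P q).1) (nullGen p v ω) (sd i))
        - ∑ i, ω i * (-fderiv ℝ (fun q => (P q).2 i) (nullGen p v ω) td
          + ∑ j, ω j * fderiv ℝ (fun q => (P q).2 i) (nullGen p v ω) (sd j))) v := by
  unfold PLbar
  simp_rw [inner_eq3]
  have h0 := hasDerivAt_comp_nullGen (h := fun q => (P q).1)
    (hP.fst.differentiable one_ne_zero) p v ω
  have hi : ∀ i, HasDerivAt (fun v => ω i * (P (nullGen p v ω)).2 i) _ v := fun i =>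
    (hasDerivAt_comp_nullGen (h := fun q => (P q).2 i)
      (((contDiff_euclidean.1 hP.snd) i).differentiable one_ne_zero) p v ω).const_mul (ω i)
  exact h0.neg.sub (HasDerivAt.fun_sum fun i _ => hi i)

lemma slashGrad_apply {P : ℝ × E3 → ℝ × E3} (hP : ContDiff ℝ 1 P) (p : ℝ × E3) {v : ℝ} (hv : 0 < v)
    {ω : E3} (hω : ‖ω‖ = 1) (i : Fin 3) :
    v ^ 2 * slashGradCone (coneA P p) v ω i =
      fderiv ℝ (fun z : ℝ × E3 => coneB P p z.1 z.2) (v, ω)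
        (0, tp ω (EuclideanSpace.single i 1)) := by
  have hω0 : ω ≠ 0 := by rintro rfl; simp at hω
  obtain ⟨N, hN, hN'⟩ := hasFDerivAt_unit hω0
  have hb := ((coneB_contDiff hP p).differentiable one_ne_zero (v, ω)).hasFDerivAt.comp ω
    (f := fun y => (v, y)) (hasFDerivAt_prodMk_right v ω)
  have hu : ‖ω‖⁻¹ • ω = ω := by simp [hω]
  have hb2 := (HasFDerivAt.comp ω (f := fun y : E3 => ‖y‖⁻¹ • y)
    (g := fun y => coneB P p v y) (by rw [hu]; exact hb) hN).mul_const v⁻¹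
  have e : fderiv ℝ (fun x => coneA P p v (‖x‖⁻¹ • x)) ω = _ := hb2.fderiv
  simp only [slashGradCone, PiLp.smul_apply, gradient_apply', smul_eq_mul, e]
  simp [hN', hω]
  field_simp

/-- the scalar identity -/
lemma scalar_identity (v B f ft P0 ps : ℝ) (w fs Ps dB : Fin 3 → ℝ) (ftt : ℝ) (fts fst : Fin 3 → ℝ)
    (fss dP : Fin 3 → Fin 3 → ℝ) (D : ℝ) (hs : ∀ i, fts i = fst i)
    (hw : -ftt + ∑ i, fss i i - P0 * ft + ∑ i, Ps i * fs i = ps) :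
    (1/2 * (-P0 + ∑ i, w i * Ps i) * B) * f + B * (-ft + ∑ i, w i * fs i)
      - ((1 * B + v * (1/2 * (-P0 + ∑ i, w i * Ps i) * B)) * (-ft - ∑ i, w i * fs i)
        + v * B * (-(-ftt + ∑ i, w i * fts i) - ∑ i, w i * (-fst i + ∑ j, w j * fss i j)))
      - 1/2 * (((1 * B + v * (1/2 * (-P0 + ∑ i, w i * Ps i) * B)) * (-P0 - ∑ i, w i * Ps i)
          + v * B * D) * f
        + v * B * (-P0 - ∑ i, w i * Ps i) * (-ft + ∑ i, w i * fs i))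
    = v * B * ps + ∑ i, dB i * fs i + (∑ i, Ps i * dB i) * f
      - B * f * (-(v * (∑ i, ∑ j, ((if i = j then 1 else 0) - w i * w j) * dP i j)
          - 2 * ∑ i, w i * Ps i) + 1/2 * v * D
          + 1/2 * (-P0 - ∑ i, w i * Ps i) - 1/2 * (-P0 + ∑ i, w i * Ps i)
          + 1/4 * v * (-P0 + ∑ i, w i * Ps i) * (-P0 - ∑ i, w i * Ps i))
      - ∑ i, (dB i * (fs i + Ps i * f)
          + B * (v * ∑ j, ((if i = j then 1 else 0) - w i * w j) *
              (fss i j + (dP i j * f + Ps i * fs j)))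
          - 2 * (w i * (B * (fs i + Ps i * f)))) := by
  subst hw
  simp only [Fin.sum_univ_three, hs]
  simp
  ring

set_option maxHeartbeats 2000000 in
/-- **Kirchhoff–Sobolev representation formula on the Minkowski backward null cone**
(scalar wave equation with a first-order term). -/
theorem kirchhoff_sobolev_minkowski_first_order
    (φ ψ : ℝ × E3 → ℝ) (P : ℝ × E3 → ℝ × E3)
    (hφ : ContDiff ℝ (⊤ : ℕ∞) φ) (hψ : ContDiff ℝ (⊤ : ℕ∞) ψ) (hP : ContDiff ℝ (⊤ : ℕ∞) P)
    (hwave : ∀ q : ℝ × E3,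
      -(dt (dt φ) q) + lap (fun y => φ (q.1, y)) q.2
        - (P q).1 * dt φ q + ⟪(P q).2, gradx φ q⟫ = ψ q)
    (p : ℝ × E3) (v₀ : ℝ) (hv₀ : 0 < v₀) :
    4 * π * φ p =
      -coneInt v₀ (fun v ω => coneA P p v ω * ψ (nullGen p v ω))
      - coneInt v₀ (fun v ω =>
          ⟪slashGradCone (coneA P p) v ω, slashGradSpace φ (nullGen p v ω) ω⟫)
      - coneInt v₀ (fun v ω =>
          ⟪Ptan P (nullGen p v ω) ω, slashGradCone (coneA P p) v ω⟫ * φ (nullGen p v ω))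
      + coneInt v₀ (fun v ω => nuP P p v ω * coneA P p v ω * φ (nullGen p v ω))
      + v₀ * ∫ ω : sphere (0 : E3) 1,
          coneB P p v₀ (ω : E3) *
            ((1/v₀) * φ (nullGen p v₀ (ω : E3))
              - Lbar φ (nullGen p v₀ (ω : E3)) (ω : E3)
              - (1/2) * PLbar P (nullGen p v₀ (ω : E3)) (ω : E3) * φ (nullGen p v₀ (ω : E3)))
          ∂sphMeasure := by
  have hφ2 : ContDiff ℝ 2 φ := contDiff_infty.1 hφ 2
  have hφ1 : ContDiff ℝ 1 φ := hφ.of_le (by exact_mod_cast le_top)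
  have hP1 : ContDiff ℝ 1 P := hP.of_le (by exact_mod_cast le_top)
  have hφd : Differentiable ℝ φ := hφ1.differentiable one_ne_zero
  let φt : ℝ × E3 → ℝ := fun q => fderiv ℝ φ q td
  let φs : Fin 3 → ℝ × E3 → ℝ := fun i q => fderiv ℝ φ q (sd i)
  let R0 : ℝ × E3 → ℝ := fun q => (P q).1
  let Rs : Fin 3 → ℝ × E3 → ℝ := fun i q => (P q).2 i
  have hφt : ContDiff ℝ 1 φt :=
    (hφ2.fderiv_right (m := 1) (by norm_num)).clm_apply contDiff_const
  have hφs : ∀ i, ContDiff ℝ 1 (φs i) := fun i =>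
    (hφ2.fderiv_right (m := 1) (by norm_num)).clm_apply contDiff_const
  have hR0 : ContDiff ℝ 1 R0 := hP1.fst
  have hRs : ∀ i, ContDiff ℝ 1 (Rs i) := contDiff_euclidean.1 hP1.snd
  let G : ℝ × E3 → ℝ × E3 := fun z => nullGen p z.1 z.2
  have hG : Continuous G := (contDiff_nullGen (n := 1) p).continuous
  let B : ℝ × E3 → ℝ := fun z => coneB P p z.1 z.2
  have hB : ContDiff ℝ 1 B := coneB_contDiff hP1 p
  have cder : ∀ {h : ℝ × E3 → ℝ}, ContDiff ℝ 1 h → ∀ a, Continuous fun z => fderiv ℝ h (G z) a :=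
    fun hh a => ((hh.continuous_fderiv one_ne_zero).comp hG).clm_apply continuous_const
  let D : ℝ × E3 → ℝ := fun z =>
    -(-fderiv ℝ R0 (G z) td + ∑ i, z.2 i * fderiv ℝ R0 (G z) (sd i))
      - ∑ i, z.2 i * (-fderiv ℝ (Rs i) (G z) td + ∑ j, z.2 j * fderiv ℝ (Rs i) (G z) (sd j))
  let L' : ℝ × E3 → ℝ := fun z =>
    -(-fderiv ℝ φt (G z) td + ∑ i, z.2 i * fderiv ℝ φt (G z) (sd i))
      - ∑ i, z.2 i * (-fderiv ℝ (φs i) (G z) td + ∑ j, z.2 j * fderiv ℝ (φs i) (G z) (sd j))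
  let PLf : ℝ × E3 → ℝ := fun z => -R0 (G z) + ∑ i, z.2 i * Rs i (G z)
  let PBf : ℝ × E3 → ℝ := fun z => -R0 (G z) - ∑ i, z.2 i * Rs i (G z)
  let LBf : ℝ × E3 → ℝ := fun z => -φt (G z) - ∑ i, z.2 i * φs i (G z)
  let fv : ℝ × E3 → ℝ := fun z => -φt (G z) + ∑ i, z.2 i * φs i (G z)
  have ePL : ∀ q ω, PL P q ω = -R0 q + ∑ i, ω i * Rs i q := fun q ω => by
    simp only [PL, inner_eq3]; rfl
  have ePB : ∀ q ω, PLbar P q ω = -R0 q - ∑ i, ω i * Rs i q := fun q ω => by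
    simp only [PLbar, inner_eq3]; rfl
  have eLB : ∀ q ω, Lbar φ q ω = -φt q - ∑ i, ω i * φs i q := fun q ω => by
    simp only [Lbar, inner_eq3, dt_eq hφd, gradx_eq hφd]; rfl
  let dB : Fin 3 → ℝ × E3 → ℝ := fun i z => fderiv ℝ B z (0, tp z.2 (EuclideanSpace.single i 1))
  have cB : Continuous B := hB.continuous
  have cφ : Continuous fun z => φ (G z) := hφ.continuous.comp hG
  have cψ : Continuous fun z => ψ (G z) := hψ.continuous.comp hG
  have cφt : Continuous fun z => φt (G z) := hφt.continuous.comp hG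
  have cφs : ∀ i, Continuous fun z => φs i (G z) := fun i => (hφs i).continuous.comp hG
  have cR0 : Continuous fun z => R0 (G z) := hR0.continuous.comp hG
  have cRs : ∀ i, Continuous fun z => Rs i (G z) := fun i => (hRs i).continuous.comp hG
  have cω : ∀ i : Fin 3, Continuous fun z : ℝ × E3 => z.2 i := fun i => by fun_prop
  have cdB : ∀ i, Continuous (dB i) := fun i => by
    refine (hB.continuous_fderiv one_ne_zero).clm_apply ?_
    unfold tp; fun_prop
  have cdR0 := cder hR0
  have cdRs := fun i => cder (hRs i)
  have cdφt := cder hφt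
  have cdφs := fun i => cder (hφs i)
  have csum : ∀ {g : Fin 3 → ℝ × E3 → ℝ}, (∀ i, Continuous (g i)) →
      Continuous fun z => ∑ i, z.2 i * g i z := fun hg =>
    continuous_finset_sum _ fun i _ => (cω i).mul (hg i)
  have cD : Continuous D := ((cdR0 td).neg.add (csum fun i => cdR0 (sd i))).neg.sub
    (csum fun i => (cdRs i td).neg.add (csum fun j => cdRs i (sd j)))
  have cL' : Continuous L' := ((cdφt td).neg.add (csum fun i => cdφt (sd i))).neg.sub
    (csum fun i => (cdφs i td).neg.add (csum fun j => cdφs i (sd j)))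
  have cPL : Continuous PLf := cR0.neg.add (csum cRs)
  have cPB : Continuous PBf := cR0.neg.sub (csum cRs)
  have cLB : Continuous LBf := cφt.neg.sub (csum cφs)
  have cfv : Continuous fv := cφt.neg.add (csum cφs)
  -- the potential and its derivative
  let J : ℝ × E3 → ℝ := fun z =>
    B z * φ (G z) - z.1 * B z * LBf z - 1/2 * (z.1 * B z * PBf z * φ (G z))
  let J' : ℝ × E3 → ℝ := fun z =>
    (1/2 * PLf z * B z) * φ (G z) + B z * fv z
      - ((1 * B z + z.1 * (1/2 * PLf z * B z)) * LBf z + z.1 * B z * L' z)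
      - 1/2 * (((1 * B z + z.1 * (1/2 * PLf z * B z)) * PBf z + z.1 * B z * D z) * φ (G z)
        + z.1 * B z * PBf z * fv z)
  have cJ : Continuous J := by
    change Continuous fun z => _
    fun_prop
  have cJ' : Continuous J' := by
    change Continuous fun z => _
    fun_prop
  have hJ : ∀ v ω, HasDerivAt (fun v => J (v, ω)) (J' (v, ω)) v := by
    intro v ω
    have b1 : HasDerivAt (fun v => B (v, ω)) (1/2 * PLf (v, ω) * B (v, ω)) v := by
      have := coneB_deriv hP1 p v ω
      rw [ePL] at this
      exact this
    have b2 : HasDerivAt (fun v => φ (G (v, ω))) (fv (v, ω)) v :=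
      hasDerivAt_comp_nullGen hφd p v ω
    have b3 : HasDerivAt (fun v => LBf (v, ω)) (L' (v, ω)) v := by
      have h0 := hasDerivAt_comp_nullGen (hφt.differentiable one_ne_zero) p v ω
      have hi : ∀ i, HasDerivAt (fun v => ω i * φs i (nullGen p v ω)) _ v := fun i =>
        (hasDerivAt_comp_nullGen ((hφs i).differentiable one_ne_zero) p v ω).const_mul (ω i)
      exact h0.neg.sub (HasDerivAt.fun_sum fun i _ => hi i)
    have b4 : HasDerivAt (fun v => PBf (v, ω)) (D (v, ω)) v := by
      have := PLbar_deriv hP1 p v ω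
      simp only [ePB] at this
      exact this
    have b5 := (hasDerivAt_id v).mul b1
    exact ((b1.mul b2).sub (b5.mul b3)).sub (((b5.mul b4).mul b2).const_mul (1/2))
  -- the pieces
  let T1 : ℝ × E3 → ℝ := fun z => z.1 * B z * ψ (G z)
  let T2 : ℝ × E3 → ℝ := fun z => ∑ i, dB i z * φs i (G z)
  let T3 : ℝ × E3 → ℝ := fun z => (∑ i, Rs i (G z) * dB i z) * φ (G z)
  let T4 : ℝ × E3 → ℝ := fun z => B z * φ (G z) *
    (-(z.1 * (∑ i, ∑ j, ((if i = j then 1 else 0) - z.2 i * z.2 j) * fderiv ℝ (Rs i) (G z) (sd j))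
          - 2 * ∑ i, z.2 i * Rs i (G z)) + 1/2 * z.1 * D z
          + 1/2 * PBf z - 1/2 * PLf z + 1/4 * z.1 * PLf z * PBf z)
  let S : Fin 3 → ℝ × E3 → ℝ := fun i z => dB i z * (φs i (G z) + Rs i (G z) * φ (G z))
          + B z * (z.1 * ∑ j, ((if i = j then 1 else 0) - z.2 i * z.2 j) *
              (fderiv ℝ (φs i) (G z) (sd j) +
                (fderiv ℝ (Rs i) (G z) (sd j) * φ (G z) + Rs i (G z) * φs j (G z))))
          - 2 * (z.2 i * (B z * (φs i (G z) + Rs i (G z) * φ (G z))))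
  have cT1 : Continuous T1 := (continuous_fst.mul cB).mul cψ
  have cT2 : Continuous T2 := continuous_finset_sum _ fun i _ => (cdB i).mul (cφs i)
  have cT3 : Continuous T3 := (continuous_finset_sum _ fun i _ => (cRs i).mul (cdB i)).mul cφ
  have cδ : ∀ i j : Fin 3, Continuous fun z : ℝ × E3 =>
      (if i = j then (1:ℝ) else 0) - z.2 i * z.2 j := fun i j =>
    continuous_const.sub ((cω i).mul (cω j))
  have cT4 : Continuous T4 := by
    have c1 : Continuous fun z : ℝ × E3 => ∑ i, ∑ j,
        ((if i = j then (1:ℝ) else 0) - z.2 i * z.2 j) * fderiv ℝ (Rs i) (G z) (sd j) :=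
      continuous_finset_sum _ fun i _ => continuous_finset_sum _ fun j _ =>
        (cδ i j).mul (cdRs i (sd j))
    have c2 := csum cRs
    change Continuous fun z => _
    fun_prop
  have cS : ∀ i, Continuous (S i) := by
    intro i
    have c1 : Continuous fun z : ℝ × E3 => ∑ j, ((if i = j then (1:ℝ) else 0) - z.2 i * z.2 j) *
              (fderiv ℝ (φs i) (G z) (sd j) +
                (fderiv ℝ (Rs i) (G z) (sd j) * φ (G z) + Rs i (G z) * φs j (G z))) :=
      continuous_finset_sum _ fun j _ =>
        (cδ i j).mul ((cdφs i (sd j)).add (((cdRs i (sd j)).mul cφ).add ((cRs i).mul (cφs j))))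
    have c2 := cω i
    have c3 := cφs i
    have c4 := cRs i
    have c5 := cdB i
    exact ((c5.mul (c3.add (c4.mul cφ))).add (cB.mul (continuous_fst.mul c1))).sub
      (continuous_const.mul (c2.mul (cB.mul (c3.add (c4.mul cφ)))))
  have ident : ∀ z, J' z = T1 z + T2 z + T3 z - T4 z - ∑ i, S i z := by
    intro z
    refine scalar_identity z.1 (B z) (φ (G z)) (φt (G z)) (R0 (G z)) (ψ (G z)) (fun i => z.2 i)
      (fun i => φs i (G z)) (fun i => Rs i (G z)) (fun i => dB i z)
      (fderiv ℝ φt (G z) td) (fun i => fderiv ℝ φt (G z) (sd i))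
      (fun i => fderiv ℝ (φs i) (G z) td) (fun i j => fderiv ℝ (φs i) (G z) (sd j))
      (fun i j => fderiv ℝ (Rs i) (G z) (sd j)) (D z) (fun i => snd_symm hφ2 _ _ _) ?_
    have := hwave (G z)
    have e1 : dt φ = φt := funext fun q => dt_eq hφd q
    rw [lap_eq hφ2, e1, dt_eq (hφt.differentiable one_ne_zero), inner_eq3] at this
    simp only [gradx_eq hφd] at this
    exact this
  have Sint : ∀ i v, ∫ ω : sphere (0 : E3) 1, S i (v, ω) ∂sphMeasure = 0 := by
    intro i v
    have hh : ContDiff ℝ 1 (fun q => φs i q + Rs i q * φ q) := (hφs i).add ((hRs i).mul hφ1)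
    have hH : ContDiff ℝ 1 (fun ω : E3 => B (v, ω) * (fun q => φs i q + Rs i q * φ q) (nullGen p v ω)) :=
      (hB.comp (by fun_prop : ContDiff ℝ 1 fun ω : E3 => (v, ω))).mul
        ((hh.comp (contDiff_nullGen p)).comp (by fun_prop : ContDiff ℝ 1 fun ω : E3 => (v, ω)))
    have sdv := sphere_div _ hH (EuclideanSpace.single i 1)
    have e1 : ∀ ω : E3, S i (v, ω) =
        fderiv ℝ (fun ω : E3 => B (v, ω) * (fun q => φs i q + Rs i q * φ q) (nullGen p v ω)) ω
          (tp ω (EuclideanSpace.single i 1)) -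
        2 * (⟪ω, EuclideanSpace.single i 1⟫ *
          (B (v, ω) * (fun q => φs i q + Rs i q * φ q) (nullGen p v ω))) := by
      intro ω
      rw [fderiv_mul_nullGen (hB.differentiable one_ne_zero) (hh.differentiable one_ne_zero)]
      have e2 : ∀ q w, fderiv ℝ (fun q => φs i q + Rs i q * φ q) q w =
          fderiv ℝ (φs i) q w + (fderiv ℝ (Rs i) q w * φ q + Rs i q * fderiv ℝ φ q w) := by
        intro q w
        have a1 := ((hφs i).differentiable one_ne_zero q).hasFDerivAt
        have a2 := ((hRs i).differentiable one_ne_zero q).hasFDerivAt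
        have a3 := (hφd q).hasFDerivAt
        have : fderiv ℝ (fun q => φs i q + Rs i q * φ q) q = _ := (a1.add (a2.mul a3)).fderiv
        rw [this]
        simp only [ContinuousLinearMap.add_apply, ContinuousLinearMap.smul_apply, smul_eq_mul]
        ring
      have e3 : ⟪ω, EuclideanSpace.single i (1:ℝ)⟫ = ω i := by
        rw [EuclideanSpace.inner_single_right]; simp
      simp only [e2, e3, tp_apply]
      rfl
    simp only [e1]
    have i1 : Continuous fun ω : E3 => fderiv ℝ (fun ω : E3 => B (v, ω) *
        (fun q => φs i q + Rs i q * φ q) (nullGen p v ω)) ω (tp ω (EuclideanSpace.single i 1)) := by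
      refine (hH.continuous_fderiv one_ne_zero).clm_apply ?_
      unfold tp; fun_prop
    have i2 : Continuous fun ω : E3 => 2 * (⟪ω, EuclideanSpace.single i 1⟫ *
          (B (v, ω) * (fun q => φs i q + Rs i q * φ q) (nullGen p v ω))) := by
      have := hH.continuous
      exact continuous_const.mul ((by fun_prop : Continuous fun ω : E3 =>
        ⟪ω, EuclideanSpace.single i (1:ℝ)⟫).mul this)
    rw [integral_sub (sph_cont_integrable i1) (sph_cont_integrable i2), integral_const_mul, sdv,
      sub_self]
  -- assembling
  have hsl : ∀ {g : ℝ × E3 → ℝ}, Continuous g → ∀ v,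
      Integrable (fun ω : sphere (0 : E3) 1 => g (v, ω)) sphMeasure := fun {g} hg v =>
    sph_cont_integrable (f := fun x => g (v, x)) (hg.comp (by fun_prop))
  have hin : ∀ v, ∫ ω : sphere (0 : E3) 1, J' (v, ω) ∂sphMeasure =
      (∫ ω : sphere (0 : E3) 1, T1 (v, ω) ∂sphMeasure) +
      (∫ ω : sphere (0 : E3) 1, T2 (v, ω) ∂sphMeasure) +
      (∫ ω : sphere (0 : E3) 1, T3 (v, ω) ∂sphMeasure) -
      (∫ ω : sphere (0 : E3) 1, T4 (v, ω) ∂sphMeasure) := by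
    intro v
    simp only [ident]
    have j2 : Integrable (fun ω : sphere (0 : E3) 1 => T1 (v, ω) + T2 (v, ω)) sphMeasure :=
      (hsl cT1 v).add (hsl cT2 v)
    have j3 : Integrable (fun ω : sphere (0 : E3) 1 => T1 (v, ω) + T2 (v, ω) + T3 (v, ω))
      sphMeasure := j2.add (hsl cT3 v)
    have j4 : Integrable (fun ω : sphere (0 : E3) 1 =>
      T1 (v, ω) + T2 (v, ω) + T3 (v, ω) - T4 (v, ω)) sphMeasure := j3.sub (hsl cT4 v)
    have jS : Integrable (fun ω : sphere (0 : E3) 1 => ∑ i, S i (v, ω)) sphMeasure :=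
      integrable_finsetSum _ fun i _ => hsl (cS i) v
    rw [integral_sub j4 jS, integral_finsetSum _ (fun i _ => hsl (cS i) v),
      integral_sub j3 (hsl cT4 v), integral_add j2 (hsl cT3 v),
      integral_add (hsl cT1 v) (hsl cT2 v)]
    simp [Sint]
  have ftc := sph_ftc J J' cJ cJ' hJ v₀ hv₀
  simp only [hin] at ftc
  have ii : ∀ {g : ℝ × E3 → ℝ}, Continuous g → IntervalIntegrable
      (fun v => ∫ ω : sphere (0 : E3) 1, g (v, ω) ∂sphMeasure) volume 0 v₀ := fun hg =>
    (sph_param_cont hg).intervalIntegrable _ _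
  rw [intervalIntegral.integral_sub (((ii cT1).add (ii cT2)).add (ii cT3)) (ii cT4),
    intervalIntegral.integral_add ((ii cT1).add (ii cT2)) (ii cT3),
    intervalIntegral.integral_add (ii cT1) (ii cT2)] at ftc
  have hJ0 : ∫ ω : sphere (0 : E3) 1, J (0, ω) ∂sphMeasure = 4 * π * φ p := by
    have : ∀ ω : E3, J (0, ω) = φ p := by
      intro ω
      simp [J, B, G, coneB, nullGen]
    have := sph_finite
    simp [*, sph_mass]
  have hJ1 : v₀ * ∫ ω : sphere (0 : E3) 1,
          coneB P p v₀ (ω : E3) *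
            ((1/v₀) * φ (nullGen p v₀ (ω : E3))
              - Lbar φ (nullGen p v₀ (ω : E3)) (ω : E3)
              - (1/2) * PLbar P (nullGen p v₀ (ω : E3)) (ω : E3) * φ (nullGen p v₀ (ω : E3)))
          ∂sphMeasure = ∫ ω : sphere (0 : E3) 1, J (v₀, ω) ∂sphMeasure := by
    rw [← integral_const_mul]
    refine integral_congr_ae (Filter.Eventually.of_forall fun ω => ?_)
    simp only [eLB, ePB, J, B, G, LBf, PBf]
    field_simp
  have sgA : ∀ v > 0, ∀ ω : E3, ‖ω‖ = 1 → ∀ i,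
      v ^ 2 * slashGradCone (coneA P p) v ω i = dB i (v, ω) := fun v hv ω hω i =>
    slashGrad_apply hP1 p hv hω i
  have orth : ∀ v (ω : E3), ‖ω‖ = 1 → ∑ i, ω i * dB i (v, ω) = 0 := by
    intro v ω hω
    have e0 : ∑ i, ω i • ((0:ℝ), tp ω (EuclideanSpace.single i 1)) = (0 : ℝ × E3) := by
      have hn : ∑ i, ω i ^ 2 = 1 := by
        rw [← EuclideanSpace.real_norm_sq_eq, hω]; norm_num
      ext j
      · simp [Prod.fst_sum]
      · simp only [Prod.snd_sum, Prod.smul_snd, WithLp.ofLp_sum, Finset.sum_apply,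
          PiLp.smul_apply, tp_apply, smul_eq_mul]
        have : ∀ i, ω i * ((if i = j then 1 else 0) - ω i * ω j) =
          (if i = j then ω i else 0) - ω i ^ 2 * ω j := fun i => by split_ifs <;> ring
        simp only [this, Finset.sum_sub_distrib, ← Finset.sum_mul, hn]
        simp
    have := congrArg (fderiv ℝ B (v, ω)) e0
    rw [map_sum, map_zero] at this
    rw [← this]
    exact Finset.sum_congr rfl fun i _ => by rw [map_smul]; rfl
  have c1 := coneInt_eq hv₀ (fun v ω => coneA P p v ω * ψ (nullGen p v ω)) T1 (by
    intro v hv ω hω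
    simp only [T1, B, G, coneA]
    field_simp)
  have c2 := coneInt_eq hv₀ (fun v ω =>
          ⟪slashGradCone (coneA P p) v ω, slashGradSpace φ (nullGen p v ω) ω⟫) T2 (by
    intro v hv ω hω
    rw [inner_eq3, Finset.mul_sum]
    have : ∀ i, v ^ 2 * (slashGradCone (coneA P p) v ω i *
        slashGradSpace φ (nullGen p v ω) ω i) =
        dB i (v, ω) * φs i (G (v, ω)) -
          ⟪ω, gradx φ (nullGen p v ω)⟫ * (ω i * dB i (v, ω)) := by
      intro i
      rw [← mul_assoc, sgA v hv ω hω]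
      simp only [slashGradSpace, PiLp.sub_apply, PiLp.smul_apply, gradx_eq hφd, smul_eq_mul]
      simp only [φs, G]
      ring
    simp only [this, Finset.sum_sub_distrib, ← Finset.mul_sum, orth v ω hω]
    simp [T2])
  have c3 := coneInt_eq hv₀ (fun v ω =>
          ⟪Ptan P (nullGen p v ω) ω, slashGradCone (coneA P p) v ω⟫ * φ (nullGen p v ω)) T3 (by
    intro v hv ω hω
    rw [inner_eq3, ← mul_assoc, Finset.mul_sum]
    have : ∀ i, v ^ 2 * (Ptan P (nullGen p v ω) ω i * slashGradCone (coneA P p) v ω i) =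
        Rs i (G (v, ω)) * dB i (v, ω) -
          ⟪ω, (P (nullGen p v ω)).2⟫ * (ω i * dB i (v, ω)) := by
      intro i
      rw [mul_left_comm, sgA v hv ω hω]
      simp only [Ptan, PiLp.sub_apply, PiLp.smul_apply, smul_eq_mul]
      simp only [Rs, G]
      ring
    simp only [this, Finset.sum_sub_distrib, ← Finset.mul_sum, orth v ω hω]
    simp [T3, G])
  have c4 := coneInt_eq hv₀ (fun v ω => nuP P p v ω * coneA P p v ω * φ (nullGen p v ω)) T4 (by
    intro v hv ω hω
    have e1 : deriv (fun w => PLbar P (nullGen p w ω) ω) v = D (v, ω) :=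
      (PLbar_deriv hP1 p v ω).deriv
    have e2 : slashDivP P (nullGen p v ω) ω v = (∑ i, ∑ j,
        ((if i = j then 1 else 0) - ω i * ω j) * fderiv ℝ (Rs i) (nullGen p v ω) (sd j))
        - 2 / v * ∑ i, ω i * Rs i (nullGen p v ω) := by
      unfold slashDivP
      rw [inner_eq3]
      congr 1
      refine Finset.sum_congr rfl fun i _ => Finset.sum_congr rfl fun j _ => ?_
      congr 1
      exact fderiv_snd_eq (φ := Rs i) ((hRs i).differentiable one_ne_zero) _ _ _
    simp only [nuP, e1, e2]
    simp only [ePL, ePB, coneA, T4, B, G, PLf, PBf]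
    field_simp)
  rw [c1, c2, c3, c4, hJ1]
  linarith [ftc, hJ0]

end
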